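/- Loss of the improved expressiveness property by regularization: assume (1/2)·(d_x + 2)·(d_x + 1) < n, that φ is continuously differentiable on an open neighborhood of the origin, twice differentiable at the origin, and φ(0, 0) = 0, and let g : ℝ^p × ℝ^{q×d_x} → [0, ∞) satisfy g(0) = 0 and suppose there exist constants c₁, c₂ > 0 and an open neighborhood U of the origin with g(z) ≥ c₁·‖z‖² for all z ∈ U and g(z) ≥ c₂ for all z ∉ U. Then for every ν > 0 there exist uncountably many y_d ∈ Y with y_d ≠ 0 such that ᾱ = 0 is the unique global minimizer of the regularized loss α ↦ ‖Ψ(α) − y_d‖_Y² + ν·g(α). -/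

import Mathlib

noncomputable section

/-- The norm `‖y‖_Y = ((1/(2n)) · Σ_k ‖y_k‖₂²)^{1/2}` on `Y = (ℝ^{d_y})^n`. -/
def normY {dy n : ℕ} (y : Fin n → Fin dy → ℝ) : ℝ :=
  Real.sqrt (1 / (2 * (n : ℝ)) * ∑ k, ∑ j, y k j ^ 2)

/-- The approximation scheme with linear lowest level:
`Ψ(β, A) = (φ(β, A·x^k))_{k=1}^n`. -/
def PsiLin {dx dy n p q : ℕ} (x : Fin n → Fin dx → ℝ)
    (φ : (Fin p → ℝ) × (Fin q → ℝ) → Fin dy → ℝ)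
    (α : (Fin p → ℝ) × (Fin q → Fin dx → ℝ)) : Fin n → Fin dy → ℝ :=
  fun k => φ (α.1, fun i => ∑ j, α.2 i j * x k j)

/-- The regularized squared loss `α ↦ ‖Ψ(α) − y‖_Y² + ν·g(α − ᾱ)`. -/
def regLoss {dx dy n p q : ℕ} (x : Fin n → Fin dx → ℝ)
    (φ : (Fin p → ℝ) × (Fin q → ℝ) → Fin dy → ℝ)
    (g : (Fin p → ℝ) × (Fin q → Fin dx → ℝ) → ℝ)
    (abar : (Fin p → ℝ) × (Fin q → Fin dx → ℝ)) (ν : ℝ)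
    (y : Fin n → Fin dy → ℝ) (α : (Fin p → ℝ) × (Fin q → Fin dx → ℝ)) : ℝ :=
  normY (PsiLin x φ α - y) ^ 2 + ν * g (α - abar)

open Asymptotics Topology Filter

/-- A function whose derivative is differentiable at `0` and which vanishes at `0` agrees with its
linearization at `0` up to a quadratic error. -/
theorem isBigO_sub_fderiv_zero {E F : Type*} [NormedAddCommGroup E] [NormedSpace ℝ E]
    [NormedAddCommGroup F] [NormedSpace ℝ F] {f : E → F}
    (hf : ∀ᶠ v in 𝓝 0, DifferentiableAt ℝ f v)
    (hf' : DifferentiableAt ℝ (fderiv ℝ f) 0) (hf0 : f 0 = 0) :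
    (fun v => f v - fderiv ℝ f 0 v) =O[𝓝 0] fun v => ‖v‖ ^ 2 := by
  obtain ⟨C, hC0, hC⟩ := hf'.isBigO_sub.exists_nonneg
  obtain ⟨r, hr, hball⟩ := Metric.eventually_nhds_iff_ball.1 (hf.and hC.bound)
  refine IsBigO.of_bound C ?_
  filter_upwards [Metric.ball_mem_nhds (0 : E) hr] with v hv
  have hsub : ∀ w ∈ Metric.closedBall (0 : E) ‖v‖, w ∈ Metric.ball (0 : E) r := fun w hw => by
    simp only [mem_closedBall_zero_iff, mem_ball_zero_iff] at *
    exact hw.trans_lt hv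
  have key := (convex_closedBall (0 : E) ‖v‖).norm_image_sub_le_of_norm_fderiv_le' (f := f)
    (φ := fderiv ℝ f 0) (C := C * ‖v‖) (fun w hw => (hball w (hsub w hw)).1)
    (fun w hw => by
      refine (hball w (hsub w hw)).2.trans ?_
      rw [sub_zero]
      exact mul_le_mul_of_nonneg_left (mem_closedBall_zero_iff.1 hw) hC0)
    (Metric.mem_closedBall_self (norm_nonneg v)) (y := v) (by simp)
  simpa [hf0, sq, mul_assoc] using key

/-- If there are more than `dx + 1` points in `ℝ^dx`, they satisfy a nontrivial affine relation. -/
theorem exists_affine_relation {dx n : ℕ} (h : dx + 1 < n) (x : Fin n → Fin dx → ℝ) :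
    ∃ z : Fin n → ℝ, z ≠ 0 ∧ ∑ k, z k = 0 ∧ ∀ j, ∑ k, z k * x k j = 0 := by
  let T : (Fin n → ℝ) →ₗ[ℝ] ℝ × (Fin dx → ℝ) :=
    (Fintype.linearCombination ℝ fun _ => (1 : ℝ)).prod (Fintype.linearCombination ℝ x)
  have hT : T.ker ≠ ⊥ := LinearMap.ker_ne_bot_of_finrank_lt (by simp; omega)
  obtain ⟨z, hz, hz0⟩ := (Submodule.ne_bot_iff _).1 hT
  rw [LinearMap.mem_ker] at hz
  refine ⟨z, hz0, ?_, fun j => ?_⟩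
  · simpa [T, Fintype.linearCombination_apply] using congrArg Prod.fst hz
  · simpa [T, Fintype.linearCombination_apply] using congrFun (congrArg Prod.snd hz) j

/-- The linear map `(β, A) ↦ (β, A w)`. -/
def lowestLevel (p q : ℕ) {dx : ℕ} (w : Fin dx → ℝ) :
    (Fin p → ℝ) × (Fin q → Fin dx → ℝ) →L[ℝ] (Fin p → ℝ) × (Fin q → ℝ) :=
  LinearMap.toContinuousLinearMap
    { toFun := fun α => (α.1, fun i => ∑ j, α.2 i j * w j)
      map_add' := fun a b => by
        ext <;> simp [add_mul, Finset.sum_add_distrib]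
      map_smul' := fun c a => by
        ext <;> simp [mul_assoc, Finset.mul_sum] }

theorem lowestLevel_apply {p q dx : ℕ} (w : Fin dx → ℝ)
    (α : (Fin p → ℝ) × (Fin q → Fin dx → ℝ)) :
    lowestLevel p q w α = (α.1, fun i => ∑ j, α.2 i j * w j) := rfl

theorem sum_smul_lowestLevel_eq_zero {p q dx n : ℕ} {x : Fin n → Fin dx → ℝ} {z : Fin n → ℝ}
    (hz : ∑ k, z k = 0) (hzx : ∀ j, ∑ k, z k * x k j = 0)
    (α : (Fin p → ℝ) × (Fin q → Fin dx → ℝ)) : ∑ k, z k • lowestLevel p q (x k) α = 0 := by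
  ext i
  · simp [lowestLevel_apply, Prod.fst_sum, ← Finset.sum_mul, hz]
  · simp only [lowestLevel_apply, Prod.snd_sum, Prod.smul_snd, Finset.sum_apply, Pi.smul_apply,
      smul_eq_mul, Finset.mul_sum, Prod.snd_zero, Pi.zero_apply]
    rw [Finset.sum_comm]
    refine Finset.sum_eq_zero fun j _ => ?_
    rw [← mul_zero (α.2 i j), ← hzx j, Finset.mul_sum]
    exact Finset.sum_congr rfl fun k _ => by ring

/-- Pairing `PsiLin` with an affine relation between the data points kills its first-order part. -/
theorem isBigO_sum_smul_psiLin {dx dy n p q : ℕ} {x : Fin n → Fin dx → ℝ}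
    {φ : (Fin p → ℝ) × (Fin q → ℝ) → Fin dy → ℝ}
    (hφ : ∀ᶠ v in 𝓝 0, DifferentiableAt ℝ φ v)
    (hφ' : DifferentiableAt ℝ (fderiv ℝ φ) 0) (hφ0 : φ 0 = 0) {z : Fin n → ℝ}
    (hz : ∑ k, z k = 0) (hzx : ∀ j, ∑ k, z k * x k j = 0) :
    (fun α => ∑ k, z k • PsiLin x φ α k) =O[𝓝 0] fun α => ‖α‖ ^ 2 := by
  have hR := isBigO_sub_fderiv_zero hφ hφ' hφ0
  have heq : (fun α => ∑ k, z k • PsiLin x φ α k) = fun α => ∑ k, z k •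
      (φ (lowestLevel p q (x k) α) - fderiv ℝ φ 0 (lowestLevel p q (x k) α)) := by
    funext α
    have := congrArg (fderiv ℝ φ 0) (sum_smul_lowestLevel_eq_zero hz hzx α)
    simp only [map_sum, map_smul, map_zero] at this
    simp only [smul_sub, Finset.sum_sub_distrib, this, sub_zero]
    rfl
  rw [heq]
  refine IsBigO.fun_sum fun k _ => ?_
  refine IsBigO.const_smul_left (E' := Fin dy → ℝ) ?_ (z k)
  have ht : Tendsto (lowestLevel p q (x k)) (𝓝 0) (𝓝 0) := by
    simpa using (lowestLevel p q (x k)).continuous.tendsto 0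
  exact (hR.comp_tendsto ht).trans (((lowestLevel p q (x k)).isBigO_id (𝓝 0)).norm_norm.pow 2)

theorem normY_sq {dy n : ℕ} (y : Fin n → Fin dy → ℝ) :
    normY y ^ 2 = 1 / (2 * (n : ℝ)) * ∑ k, ∑ j, y k j ^ 2 :=
  Real.sq_sqrt (by positivity)

/-- Expansion of the squared distance to a label supported in a single output coordinate. -/
theorem normY_sub_single_sq {dy n : ℕ} (u : Fin n → Fin dy → ℝ) (z : Fin n → ℝ) (j₀ : Fin dy)
    (s : ℝ) :
    normY (u - s • fun k => Pi.single j₀ (z k)) ^ 2 =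
      normY u ^ 2 - 2 * s * (1 / (2 * (n : ℝ)) * (∑ k, z k • u k) j₀) +
        s ^ 2 * (1 / (2 * (n : ℝ)) * ∑ k, z k ^ 2) := by
  have h : ∀ k, ∑ j, (u - s • (fun k => Pi.single j₀ (z k) : Fin n → Fin dy → ℝ)) k j ^ 2 =
      ∑ j, u k j ^ 2 - 2 * s * (z k * u k j₀) + s ^ 2 * z k ^ 2 := fun k => by
    have : ∀ j, (u - s • (fun k => Pi.single j₀ (z k) : Fin n → Fin dy → ℝ)) k j ^ 2 =
        u k j ^ 2 + if j = j₀ then s ^ 2 * z k ^ 2 - 2 * s * (z k * u k j) else 0 := fun j => by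
      by_cases hj : j = j₀
      · subst hj
        simp
        ring
      · simp [hj]
    simp only [this, Finset.sum_add_distrib, Finset.sum_ite_eq', Finset.mem_univ, if_true]
    ring
  simp only [normY_sq, h, Finset.sum_add_distrib, Finset.sum_sub_distrib, ← Finset.mul_sum,
    Finset.sum_apply, Pi.smul_apply, smul_eq_mul]
  ring

theorem regularization_kills_expressiveness
    (dx dy n p q : ℕ) (hn : 2 ≤ n) (hdx : 1 ≤ dx) (hdy : 1 ≤ dy)
    (hp : 1 ≤ p) (hq : 1 ≤ q)
    (hbig : (dx + 2) * (dx + 1) < 2 * n)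
    (x : Fin n → Fin dx → ℝ)
    (φ : (Fin p → ℝ) × (Fin q → ℝ) → Fin dy → ℝ)
    (hcone : ∀ y ∈ Set.range (PsiLin x φ), ∀ s : ℝ, 0 < s →
      s • y ∈ Set.range (PsiLin x φ))
    (hexpr : ∀ y : Fin n → Fin dy → ℝ, y ≠ 0 →
      sInf (Set.range fun α => normY (PsiLin x φ α - y) ^ 2) < normY y ^ 2)
    (hφ1 : ∃ U : Set ((Fin p → ℝ) × (Fin q → ℝ)),
      IsOpen U ∧ (0 : (Fin p → ℝ) × (Fin q → ℝ)) ∈ U ∧ ContDiffOn ℝ 1 φ U)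
    (hφ2 : DifferentiableAt ℝ (fderiv ℝ φ) (0 : (Fin p → ℝ) × (Fin q → ℝ)))
    (hφ0 : φ (0, 0) = 0)
    (g : (Fin p → ℝ) × (Fin q → Fin dx → ℝ) → ℝ)
    (hgnn : ∀ z, 0 ≤ g z) (hg0 : g 0 = 0)
    (hgq : ∃ c₁ c₂ : ℝ, 0 < c₁ ∧ 0 < c₂ ∧
      ∃ U : Set ((Fin p → ℝ) × (Fin q → Fin dx → ℝ)),
        IsOpen U ∧ (0 : (Fin p → ℝ) × (Fin q → Fin dx → ℝ)) ∈ U ∧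
        (∀ z ∈ U, c₁ * ‖z‖ ^ 2 ≤ g z) ∧ (∀ z ∉ U, c₂ ≤ g z)) :
    ∀ ν : ℝ, 0 < ν →
      ¬ Set.Countable {yd : Fin n → Fin dy → ℝ | yd ≠ 0 ∧
        ∀ α : (Fin p → ℝ) × (Fin q → Fin dx → ℝ), α ≠ 0 →
          normY (PsiLin x φ 0 - yd) ^ 2 + ν * g 0 <
            normY (PsiLin x φ α - yd) ^ 2 + ν * g α} := by
  intro ν hν
  obtain ⟨W, hWo, hW0, hW⟩ := hφ1
  obtain ⟨c₁, c₂, hc₁, hc₂, U, hUo, hU0, hgU, hgU'⟩ := hgq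
  have hdiff : ∀ᶠ v in 𝓝 0, DifferentiableAt ℝ φ v := by
    filter_upwards [hWo.mem_nhds hW0] with v hv
    exact (hW.differentiableOn one_ne_zero).differentiableAt (hWo.mem_nhds hv)
  obtain ⟨z, hz0, hz, hzx⟩ := exists_affine_relation (by nlinarith) x
  obtain ⟨C, hC⟩ := (isBigO_sum_smul_psiLin hdiff hφ2 hφ0 hz hzx).bound
  obtain ⟨r, hr, hball⟩ := Metric.eventually_nhds_iff_ball.1 hC
  have hfar : ∀ α, α ∉ Metric.ball 0 r ∩ U → min (c₁ * r ^ 2) c₂ ≤ g α := fun α hα => by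
    by_cases hαU : α ∈ U
    · have hα' : r ≤ ‖α‖ := by simpa [hαU] using hα
      exact (min_le_left _ _).trans (le_trans (by gcongr) (hgU α hαU))
    · exact (min_le_right _ _).trans (hgU' α hαU)
  set m := min (c₁ * r ^ 2) c₂ with hm
  have hm0 : 0 < m := lt_min (by positivity) hc₂
  set K : ℝ := 1 / (2 * (n : ℝ)) with hK
  have hK0 : 0 ≤ K := by positivity
  set Z : ℝ := ∑ k, z k ^ 2 with hZ
  let j₀ : Fin dy := ⟨0, hdy⟩
  have hsmall : ∀ᶠ s : ℝ in 𝓝 0, 2 * s * (K * C) < ν * c₁ ∧ s ^ 2 * (K * Z) < ν * m := by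
    refine Eventually.and ?_ ?_
    · exact (show Continuous fun s : ℝ => 2 * s * (K * C) by fun_prop).continuousAt.eventually_lt
        continuousAt_const (by simpa using mul_pos hν hc₁)
    · exact (show Continuous fun s : ℝ => s ^ 2 * (K * Z) by fun_prop).continuousAt.eventually_lt
        continuousAt_const (by simpa using mul_pos hν hm0)
  obtain ⟨δ, hδ, hsδ⟩ := Metric.eventually_nhds_iff_ball.1 hsmall
  have hlabel : (fun k => Pi.single j₀ (z k) : Fin n → Fin dy → ℝ) ≠ 0 := fun h => hz0 <| by
    funext k
    simpa using congrFun (congrFun h k) j₀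
  have hΨ0 : PsiLin x φ 0 = 0 := by
    funext k
    have h : PsiLin x φ 0 k = φ (0, 0) := by
      simp [PsiLin, ← Pi.zero_def]
    rw [h, hφ0, Pi.zero_apply]
  intro hcount
  have himage := hcount.preimage (smul_left_injective ℝ hlabel)
  have hIoo : (Set.Ioo 0 δ).Countable := himage.mono fun s ⟨hs0, hs1⟩ => by
    obtain ⟨hs2, hs3⟩ := hsδ s (by simpa [abs_of_pos hs0] using hs1)
    refine ⟨smul_ne_zero hs0.ne' hlabel, fun α hα => ?_⟩
    have hpos : 0 ≤ normY (PsiLin x φ α - s • fun k => Pi.single j₀ (z k)) ^ 2 := sq_nonneg _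
    have hzero : normY (0 : Fin n → Fin dy → ℝ) ^ 2 = 0 := by simp [normY_sq]
    simp only [hΨ0, normY_sub_single_sq, hzero, hg0, ← hK, ← hZ] at hpos ⊢
    simp only [Pi.zero_apply, smul_zero, Finset.sum_const_zero, mul_zero, sub_zero, zero_add,
      add_zero]
    by_cases hnear : α ∈ Metric.ball 0 r ∩ U
    · have hB : (∑ k, z k • PsiLin x φ α k) j₀ ≤ C * ‖α‖ ^ 2 := by
        have h := (norm_le_pi_norm _ j₀).trans (hball α hnear.1)
        rw [norm_pow, norm_norm] at h
        exact (le_abs_self _).trans h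
      have hB' := mul_le_mul_of_nonneg_left hB (by positivity : 0 ≤ 2 * s * K)
      have hg' := mul_le_mul_of_nonneg_left (hgU α hnear.2) hν.le
      have hα' : 0 < ‖α‖ ^ 2 := pow_pos (norm_pos_iff.2 hα) 2
      have hlt := mul_lt_mul_of_pos_right hs2 hα'
      nlinarith [sq_nonneg (normY (PsiLin x φ α))]
    · have := mul_le_mul_of_nonneg_left (hfar α hnear) hν.le
      linarith
  exact absurd (Cardinal.Real.Ioo_countable_iff.1 hIoo) (not_le.2 hδ)
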